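/- In the λnsub-calculus, for every k ∈ ℕ∪{ω}, a term t is S_k-normal if and only if t belongs to the grammar no_k defined mutually by: ne_0 ::= x | ne_0 t; ne_{i+1} ::= x | ne_{i+1} no_i (i ∈ ℕ); ne_ω ::= x | ne_ω no_ω; no_k ::= λx.no_k | ne_k. -/

import Mathlib

/-- `i`-fold composition of a relation: `nSteps R i a b` holds iff `a` goes to
`b` in exactly `i` `R`-steps. -/
def nSteps {α : Type} (R : α → α → Prop) : ℕ → α → α → Prop
  | 0, a, b => a = b
  | n + 1, a, b => ∃ c, R a c ∧ nSteps R n c b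

/-- Terms of the λnsub-calculus (call-by-name with explicit substitutions at
a distance): `sub t x u` is the explicit substitution `t[x←u]`, binding `x`
in `t`. -/
inductive NTerm : Type
  | var : ℕ → NTerm
  | lam : ℕ → NTerm → NTerm
  | app : NTerm → NTerm → NTerm
  | sub : NTerm → ℕ → NTerm → NTerm

/-- Free variables. -/
def NTerm.fv : NTerm → Finset ℕ
  | .var x => {x}
  | .lam x t => NTerm.fv t \ {x}
  | .app t u => NTerm.fv t ∪ NTerm.fv u
  | .sub t x u => (NTerm.fv t \ {x}) ∪ NTerm.fv u

/-- Meta-level substitution `t{x:=u}`. -/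
def NTerm.subst : NTerm → ℕ → NTerm → NTerm
  | .var y, x, v => if y = x then v else .var y
  | .lam y t, x, v => if y = x then .lam y t else .lam y (NTerm.subst t x v)
  | .app t u, x, v => .app (NTerm.subst t x v) (NTerm.subst u x v)
  | .sub t y u, x, v =>
      if y = x then .sub t y (NTerm.subst u x v)
      else .sub (NTerm.subst t x v) y (NTerm.subst u x v)

/-- List contexts `L ::= ⟨⟩ | L[x←t]`. -/
inductive NLCtx : Type
  | hole : NLCtx
  | sub : NLCtx → ℕ → NTerm → NLCtx

def NLCtx.plug : NLCtx → NTerm → NTerm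
  | .hole, t => t
  | .sub L x u, t => NTerm.sub (NLCtx.plug L t) x u

def NLCtx.binders : NLCtx → Finset ℕ
  | .hole => ∅
  | .sub L x _ => insert x (NLCtx.binders L)

/-- Root rewrite rules (βn) and (sn); the side condition says that no free
variable of `t` is captured by the list context `L`. -/
inductive NRoot : NTerm → NTerm → Prop
  | beta (L : NLCtx) (x : ℕ) (s t : NTerm)
      (hcap : ∀ y ∈ NLCtx.binders L, y ∉ NTerm.fv t) :
      NRoot (.app (NLCtx.plug L (.lam x s)) t) (NLCtx.plug L (.sub s x t))
  | subn (t : NTerm) (x : ℕ) (u : NTerm) :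
      NRoot (.sub t x u) (NTerm.subst t x u)

/-- Stratified reduction `→_{n_k}` for `k ∈ ℕ∪{ω}`, where `ω` is `⊤ : ℕ∞`:
the closure of the root rules under stratified contexts `S_k`.  Abstraction
bodies and left subterms keep the same level, while argument positions
(`t S` and `t[x←S]`) raise the level by one; since `⊤ + 1 = ⊤`, level `⊤`
(i.e. `ω`, full reduction) allows reduction anywhere, while level `0`
(surface reduction) forbids reduction inside arguments. -/
inductive NStep : ℕ∞ → NTerm → NTerm → Prop
  | root (k : ℕ∞) {t u : NTerm} : NRoot t u → NStep k t u
  | lam {k : ℕ∞} (x : ℕ) {t t' : NTerm} :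
      NStep k t t' → NStep k (.lam x t) (.lam x t')
  | appL {k : ℕ∞} {t t' : NTerm} (u : NTerm) :
      NStep k t t' → NStep k (.app t u) (.app t' u)
  | appR {k : ℕ∞} (t : NTerm) {u u' : NTerm} :
      NStep k u u' → NStep (k + 1) (.app t u) (.app t u')
  | subL {k : ℕ∞} {t t' : NTerm} (x : ℕ) (u : NTerm) :
      NStep k t t' → NStep k (.sub t x u) (.sub t' x u)
  | subR {k : ℕ∞} (t : NTerm) (x : ℕ) {u u' : NTerm} :
      NStep k u u' → NStep (k + 1) (.sub t x u) (.sub t x u')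

/-- `S_k`-normal terms: no `→_{n_k}` step applies. -/
def NNormal (k : ℕ∞) (t : NTerm) : Prop := ∀ u, ¬ NStep k t u

/-- Testing contexts `T ::= ⟨⟩ | T u | (λx.T) u`. -/
inductive NTCtx : Type
  | hole : NTCtx
  | app : NTCtx → NTerm → NTCtx
  | lamApp : ℕ → NTCtx → NTerm → NTCtx

def NTCtx.plug : NTCtx → NTerm → NTerm
  | .hole, t => t
  | .app T u, t => .app (NTCtx.plug T t) u
  | .lamApp x T u, t => .app (.lam x (NTCtx.plug T t)) u

/-- A term is meaningful if some testing context sends it to the identity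
`λz.z` by surface reduction; otherwise it is meaningless. -/
def NMeaningful (t : NTerm) : Prop :=
  ∃ (T : NTCtx) (z : ℕ),
    Relation.ReflTransGen (NStep 0) (NTCtx.plug T t) (.lam z (.var z))

/-- Full (one-hole) contexts `C ::= ⟨⟩ | λx.C | C t | t C | C[x←t] | t[x←C]`. -/
inductive NFCtx : Type
  | hole : NFCtx
  | lam : ℕ → NFCtx → NFCtx
  | appL : NFCtx → NTerm → NFCtx
  | appR : NTerm → NFCtx → NFCtx
  | subL : NFCtx → ℕ → NTerm → NFCtx
  | subR : NTerm → ℕ → NFCtx → NFCtx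

def NFCtx.plug : NFCtx → NTerm → NTerm
  | .hole, t => t
  | .lam x C, t => .lam x (NFCtx.plug C t)
  | .appL C u, t => .app (NFCtx.plug C t) u
  | .appR u C, t => .app u (NFCtx.plug C t)
  | .subL C x u, t => .sub (NFCtx.plug C t) x u
  | .subR u x C, t => .sub u x (NFCtx.plug C t)

mutual
  /-- Grammar `ne_k` (neutral normal forms): `app0` is the level-`0` clause
  `ne_0 t` (arbitrary argument); `appS` covers the clauses `ne_{i+1} no_i`
  at level `i+1` and `ne_ω no_ω` at level `ω` (since `⊤ + 1 = ⊤`). -/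
  inductive NNe : ℕ∞ → NTerm → Prop
    | var (k : ℕ∞) (x : ℕ) : NNe k (.var x)
    | app0 {t : NTerm} (u : NTerm) : NNe 0 t → NNe 0 (.app t u)
    | appS {k : ℕ∞} {t u : NTerm} :
        NNe (k + 1) t → NNo k u → NNe (k + 1) (.app t u)
  /-- Grammar `no_k` of `S_k`-normal forms. -/
  inductive NNo : ℕ∞ → NTerm → Prop
    | lam {k : ℕ∞} (x : ℕ) {t : NTerm} : NNo k t → NNo k (.lam x t)
    | ne {k : ℕ∞} {t : NTerm} : NNe k t → NNo k t
end

theorem NNe.ne_plug_lam {k : ℕ∞} {t : NTerm} (h : NNe k t) (L : NLCtx) (x : ℕ) (s : NTerm) :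
    t ≠ L.plug (.lam x s) := by
  rintro rfl
  cases L <;> simp only [NLCtx.plug] at h <;> cases h

theorem NNormal.of_lam {k : ℕ∞} {x : ℕ} {t : NTerm} (h : NNormal k (.lam x t)) :
    NNormal k t :=
  fun _ hu => h _ (.lam x hu)

theorem NNormal.app_left {k : ℕ∞} {t u : NTerm} (h : NNormal k (.app t u)) : NNormal k t :=
  fun _ ht => h _ (.appL u ht)

theorem NNormal.app_right {k : ℕ∞} {t u : NTerm} (h : NNormal (k + 1) (.app t u)) :
    NNormal k u :=
  fun _ hu => h _ (.appR t hu)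

theorem not_nNormal_app_lam (k : ℕ∞) (x : ℕ) (s t : NTerm) :
    ¬ NNormal k (.app (.lam x s) t) :=
  fun h => h _ (.root k (.beta .hole x s t (by simp [NLCtx.binders])))

theorem not_nNormal_sub (k : ℕ∞) (t : NTerm) (x : ℕ) (u : NTerm) : ¬ NNormal k (.sub t x u) :=
  fun h => h _ (.root k (.subn t x u))

theorem NNormal.nNo {k : ℕ∞} {t : NTerm} (h : NNormal k t) : NNo k t := by
  induction t generalizing k with
  | var x => exact .ne (.var k x)
  | lam x t ih => exact .lam x (ih h.of_lam)
  | sub t x u => exact absurd h (not_nNormal_sub k t x u)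
  | app t u iht ihu =>
    cases iht h.app_left with
    | lam x _ => exact absurd h (not_nNormal_app_lam k x _ u)
    | ne ht =>
      rcases eq_or_ne k 0 with rfl | hk
      · exact .ne (.app0 u ht)
      · obtain ⟨i, rfl⟩ : ∃ i, k = i + 1 :=
          ⟨k - 1, (tsub_add_cancel_of_le (Order.one_le_iff_ne_zero.2 hk)).symm⟩
        exact .ne (.appS ht (ihu h.app_right))

theorem NNormal.lam {k : ℕ∞} {t : NTerm} (h : NNormal k t) (x : ℕ) :
    NNormal k (.lam x t) := by
  intro v hv
  cases hv with
  | root _ hr => cases hr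
  | lam _ hs => exact h _ hs

theorem NNormal.app {k : ℕ∞} {t u : NTerm} (hne : NNe k t) (ht : NNormal k t)
    (hu : ∀ i, k = i + 1 → NNormal i u) : NNormal k (.app t u) := by
  intro v hv
  generalize hw : NTerm.app t u = w at hv
  cases hv with
  | root _ hr =>
    cases hr with
    | beta L x s t' _ => exact hne.ne_plug_lam L x s (NTerm.app.inj hw).1
    | subn => cases hw
  | appL _ hs => cases hw; exact ht _ hs
  | appR _ hs => cases hw; exact hu _ rfl _ hs
  | lam | subL | subR => cases hw

mutual

theorem NNe.nNormal {k : ℕ∞} {t : NTerm} : NNe k t → NNormal k t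
  | .var _ _ => by
    intro v hv
    cases hv with
    | root _ hr => cases hr
  | .app0 _ ht => .app ht ht.nNormal fun _ hi => absurd hi.symm (by simp)
  | .appS ht hu => .app ht ht.nNormal fun i hi => by
    obtain rfl := (ENat.add_left_injective_of_ne_top ENat.one_ne_top) hi
    exact hu.nNormal

theorem NNo.nNormal {k : ℕ∞} {t : NTerm} : NNo k t → NNormal k t
  | .lam x ht => ht.nNormal.lam x
  | .ne ht => ht.nNormal

end

/-- In the λnsub-calculus, for every `k ∈ ℕ∪{ω}`, a term
`t` is `S_k`-normal iff it belongs to the grammar `no_k`. -/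
theorem nsub_normal_iff_no (k : ℕ∞) (t : NTerm) :
    NNormal k t ↔ NNo k t := by
  exact ⟨NNormal.nNo, NNo.nNormal⟩
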